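/- Let α > 0 and let F : [0,∞) × ℝ → ℝ be bounded, with F and ∂ₓF α-Hölder continuous on [0,∞) × ℝ, such that for every (t,x) ∈ (0,∞) × ℝ the time derivative ∂ₜF(t,x) and the principal value H̃[F(t,·)](x) exist and ∂ₜF(t,x) + (∂ₓF(t,x))₊ H̃[F(t,·)](x) = 0. Then F is a viscosity solution of ∂ₜF + (∂ₓF)₊ H̃[F] = 0 on (0,∞) × ℝ. -/

import Mathlib

open Filter Set MeasureTheory Topology

/-- The principal value `H̃[φ](x) = pv ∫ (φ(x) - φ(y))/(x-y)² dy` converges to `L`. -/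
def HTildeTendsto (φ : ℝ → ℝ) (x L : ℝ) : Prop :=
  Tendsto (fun ε : ℝ => ∫ y in {y : ℝ | ε ≤ |x - y|}, (φ x - φ y) / (x - y) ^ 2)
    (𝓝[>] 0) (𝓝 L)

/-- The value of the principal value `H̃[φ](x)` (junk value if the limit does not exist). -/
noncomputable def HTilde (φ : ℝ → ℝ) (x : ℝ) : ℝ :=
  limUnder (𝓝[>] (0 : ℝ))
    (fun ε : ℝ => ∫ y in {y : ℝ | ε ≤ |x - y|}, (φ x - φ y) / (x - y) ^ 2)

/-- Test functions: continuously differentiable in time and, for each time, bounded in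
space, twice differentiable in space with bounded second spatial derivative. -/
def TestFun (φ : ℝ → ℝ → ℝ) : Prop :=
  (∀ x, ContDiff ℝ 1 fun t => φ t x) ∧
  ∀ t : ℝ,
    (∃ M, ∀ x, |φ t x| ≤ M) ∧
    (∀ x, DifferentiableAt ℝ (φ t) x) ∧
    (∀ x, DifferentiableAt ℝ (deriv (φ t)) x) ∧
    (∃ M, ∀ x, |deriv (deriv (φ t)) x| ≤ M)

/-- Viscosity subsolution of `∂ₜF + (∂ₓF)₊ Op[F] = 0` on `(0,∞) × ℝ`. -/
def IsSubsolution (Op : (ℝ → ℝ) → ℝ → ℝ) (F : ℝ → ℝ → ℝ) : Prop :=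
  UpperSemicontinuousOn (fun p : ℝ × ℝ => F p.1 p.2) (Set.Ici 0 ×ˢ Set.univ) ∧
  ∀ φ : ℝ → ℝ → ℝ, TestFun φ → ∀ t₀ x₀ : ℝ, 0 < t₀ →
    (∀ t x : ℝ, 0 ≤ t → (t, x) ≠ (t₀, x₀) → F t x - φ t x < F t₀ x₀ - φ t₀ x₀) →
    deriv (fun t => φ t x₀) t₀ + max (deriv (φ t₀) x₀) 0 * Op (φ t₀) x₀ ≤ 0

/-- Viscosity supersolution of `∂ₜF + (∂ₓF)₊ Op[F] = 0` on `(0,∞) × ℝ`. -/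
def IsSupersolution (Op : (ℝ → ℝ) → ℝ → ℝ) (F : ℝ → ℝ → ℝ) : Prop :=
  LowerSemicontinuousOn (fun p : ℝ × ℝ => F p.1 p.2) (Set.Ici 0 ×ˢ Set.univ) ∧
  ∀ φ : ℝ → ℝ → ℝ, TestFun φ → ∀ t₀ x₀ : ℝ, 0 < t₀ →
    (∀ t x : ℝ, 0 ≤ t → (t, x) ≠ (t₀, x₀) → F t₀ x₀ - φ t₀ x₀ < F t x - φ t x) →
    0 ≤ deriv (fun t => φ t x₀) t₀ + max (deriv (φ t₀) x₀) 0 * Op (φ t₀) x₀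

/-- Lower semicontinuous envelope `F₋(t,x) = liminf_{0 ≤ s → t, y → x} F(s,y)`. -/
noncomputable def lscEnv (F : ℝ → ℝ → ℝ) (t x : ℝ) : ℝ :=
  liminf (fun p : ℝ × ℝ => F p.1 p.2) (𝓝[Set.Ici 0 ×ˢ Set.univ] (t, x))

/-- Viscosity solution: an usc subsolution whose lsc envelope is a supersolution. -/
def IsSolution (Op : (ℝ → ℝ) → ℝ → ℝ) (F : ℝ → ℝ → ℝ) : Prop :=
  IsSubsolution Op F ∧ IsSupersolution Op (fun t x => lscEnv F t x)

/-- A bounded continuous function has integrable truncated singular kernels. -/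
theorem integrableOn_truncated_kernel {f : ℝ → ℝ} (hf : Continuous f) {M : ℝ}
    (hM : ∀ y, |f y| ≤ M) (x : ℝ) {ε : ℝ} (hε : 0 < ε) :
    IntegrableOn (fun y => (f x - f y) / (x - y) ^ 2) {y : ℝ | ε ≤ |x - y|} := by
  have hS : MeasurableSet {y : ℝ | ε ≤ |x - y|} :=
    measurableSet_le measurable_const (by fun_prop)
  have hdom : Integrable (fun y : ℝ => (2 * M * (1 + (ε ^ 2)⁻¹)) * (1 + (x - y) ^ 2)⁻¹) :=
    (integrable_inv_one_add_sq.comp_sub_left x).const_mul _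
  refine Integrable.mono' hdom.integrableOn ?_ ?_
  · have : Measurable fun y => (f x - f y) / (x - y) ^ 2 := by
      have := hf.measurable
      fun_prop
    exact this.aestronglyMeasurable
  · refine (ae_restrict_iff' hS).2 (Eventually.of_forall fun y hy => ?_)
    have hy' : ε ≤ |x - y| := hy
    have hsq : ε ^ 2 ≤ (x - y) ^ 2 := by
      rw [← sq_abs (x - y)]
      gcongr
    have hε2 : 0 < ε ^ 2 := by positivity
    have hpos : 0 < (x - y) ^ 2 := hε2.trans_le hsq
    have hnum : |f x - f y| ≤ 2 * M := by
      have := abs_sub (f x) (f y)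
      linarith [hM x, hM y]
    have hM0 : 0 ≤ M := (abs_nonneg _).trans (hM x)
    have hkernel : ((x - y) ^ 2)⁻¹ ≤ (1 + (ε ^ 2)⁻¹) * (1 + (x - y) ^ 2)⁻¹ := by
      rw [← div_eq_mul_inv, le_div_iff₀ (by positivity), mul_add, inv_mul_cancel₀ hpos.ne', mul_one]
      linarith [inv_anti₀ hε2 hsq]
    rw [Real.norm_eq_abs, abs_div, abs_of_pos hpos, div_eq_mul_inv, mul_assoc]
    gcongr

/-- If `f - g` is maximal at `x`, the principal values at `x` are ordered accordingly. -/
theorem HTildeTendsto.le_of_increment_le {f g : ℝ → ℝ} (hf : Continuous f) (hg : Continuous g)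
    {Mf Mg : ℝ} (hMf : ∀ y, |f y| ≤ Mf) (hMg : ∀ y, |g y| ≤ Mg) {x Lf Lg : ℝ}
    (hLf : HTildeTendsto f x Lf) (hLg : HTildeTendsto g x Lg)
    (h : ∀ y, f x - f y ≤ g x - g y) : Lf ≤ Lg := by
  refine le_of_tendsto_of_tendsto hLf hLg ?_
  filter_upwards [self_mem_nhdsWithin] with ε hε
  refine integral_mono (integrableOn_truncated_kernel hf hMf x hε)
    (integrableOn_truncated_kernel hg hMg x hε) fun y => ?_
  exact div_le_div_of_nonneg_right (h y) (sq_nonneg _)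

/-- Quadratic bound on symmetric second differences. -/
theorem abs_symmetric_difference_le {f : ℝ → ℝ} (hf : ∀ x, DifferentiableAt ℝ f x)
    (hf' : ∀ x, DifferentiableAt ℝ (deriv f) x) {K : ℝ}
    (hK : ∀ x, |deriv (deriv f) x| ≤ K) (x z : ℝ) :
    |2 * f x - f (x + z) - f (x - z)| ≤ 2 * K * z ^ 2 := by
  have hK0 : 0 ≤ K := (abs_nonneg _).trans (hK x)
  have hlip (a b : ℝ) : |deriv f a - deriv f b| ≤ K * |a - b| :=
    convex_univ.norm_image_sub_le_of_norm_deriv_le (fun y _ => hf' y) (fun y _ => hK y)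
      (mem_univ b) (mem_univ a)
  have hderiv (w : ℝ) : HasDerivAt (fun w => 2 * f x - f (x + w) - f (x - w))
      (-deriv f (x + w) + deriv f (x - w)) w := by
    have h₁ := (hf (x + w)).hasDerivAt.comp_const_add x w
    have h₂ := (hf (x - w)).hasDerivAt.comp_const_sub x w
    exact ((h₁.const_sub (2 * f x)).sub h₂).congr_deriv (by ring)
  have hbound : ∀ w ∈ uIcc 0 z, ‖-deriv f (x + w) + deriv f (x - w)‖ ≤ 2 * K * |z| := by
    intro w hw
    have hwz : |w| ≤ |z| := by simpa using abs_sub_left_of_mem_uIcc hw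
    have hw' := hlip (x - w) (x + w)
    rw [show x - w - (x + w) = -(2 * w) by ring, abs_neg, abs_mul, abs_two] at hw'
    rw [Real.norm_eq_abs, neg_add_eq_sub]
    nlinarith
  have := (convex_uIcc 0 z).norm_image_sub_le_of_norm_hasDerivWithin_le
    (fun w _ => (hderiv w).hasDerivWithinAt) hbound left_mem_uIcc right_mem_uIcc
  rw [← sq_abs z, pow_two, ← mul_assoc]
  simpa [two_mul] using this

/-- The principal value exists for bounded functions with bounded second derivative. -/
theorem exists_hTildeTendsto {f : ℝ → ℝ} {M K : ℝ} (hM : ∀ y, |f y| ≤ M)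
    (hf : ∀ x, DifferentiableAt ℝ f x) (hf' : ∀ x, DifferentiableAt ℝ (deriv f) x)
    (hK : ∀ x, |deriv (deriv f) x| ≤ K) (x : ℝ) : ∃ L, HTildeTendsto f x L := by
  have hcont : Continuous f := continuous_iff_continuousAt.2 fun y => (hf y).continuousAt
  set g : ℝ → ℝ := fun z => (2 * f x - f (x + z) - f (x - z)) / z ^ 2 with hg
  have hK0 : 0 ≤ K := (abs_nonneg _).trans (hK x)
  have hM0 : 0 ≤ M := (abs_nonneg _).trans (hM x)
  have hgm : Measurable g := by
    have := hcont.measurable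
    fun_prop
  have hg_int : Integrable g := by
    refine (integrable_inv_one_add_sq.const_mul (2 * K + 4 * M)).mono'
      hgm.aestronglyMeasurable (Eventually.of_forall fun z => ?_)
    rcases eq_or_ne z 0 with rfl | hz
    · simp only [hg]
      norm_num
      positivity
    have hz2 : 0 < z ^ 2 := by positivity
    have h₁ := abs_symmetric_difference_le hf hf' hK x z
    have h₂ : |2 * f x - f (x + z) - f (x - z)| ≤ 4 * M := by
      have e₁ := abs_le.1 (hM x)
      have e₂ := abs_le.1 (hM (x + z))
      have e₃ := abs_le.1 (hM (x - z))
      exact abs_le.2 ⟨by linarith, by linarith⟩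
    rw [Real.norm_eq_abs, abs_div, abs_of_pos hz2, ← div_eq_mul_inv,
      div_le_div_iff₀ hz2 (by positivity)]
    nlinarith
  have hS (ε : ℝ) : MeasurableSet {z : ℝ | ε ≤ |z|} :=
    measurableSet_le measurable_const (by fun_prop)
  have hlim : Tendsto (fun ε : ℝ => ∫ z in {z : ℝ | ε ≤ |z|}, g z) (𝓝[>] 0) (𝓝 (∫ z, g z)) := by
    simp_rw [← integral_indicator (hS _)]
    refine tendsto_integral_filter_of_dominated_convergence (fun z => ‖g z‖) ?_ ?_ hg_int.norm ?_
    · exact Eventually.of_forall fun ε => (hgm.indicator (hS ε)).aestronglyMeasurable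
    · exact Eventually.of_forall fun ε => Eventually.of_forall fun z => norm_indicator_le_norm_self _ _
    · refine Eventually.of_forall fun z => ?_
      rcases eq_or_ne z 0 with rfl | hz
      · simp [hg, indicator]
      · refine tendsto_const_nhds.congr' ?_
        filter_upwards [nhdsWithin_le_nhds (Iio_mem_nhds (abs_pos.2 hz))] with ε hε
        exact (indicator_of_mem (show z ∈ {z : ℝ | ε ≤ |z|} from (mem_Iio.1 hε).le) g).symm
  refine ⟨(∫ z, g z) / 2, (hlim.div_const 2).congr' ?_⟩
  filter_upwards [self_mem_nhdsWithin] with ε hε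
  have hint := (integrable_indicator_iff
    (measurableSet_le measurable_const (by fun_prop))).2
      (integrableOn_truncated_kernel hcont hM x hε)
  set k := {y : ℝ | ε ≤ |x - y|}.indicator fun y => (f x - f y) / (x - y) ^ 2 with hk
  have hsum : {z : ℝ | ε ≤ |z|}.indicator g = fun z => k (x + z) + k (x - z) := by
    funext z
    by_cases hz : ε ≤ |z|
    · simp [hk, hg, indicator, hz]
      ring
    · simp [hk, indicator, hz]
  rw [← integral_indicator (hS ε), hsum,
    integral_add (hint.comp_add_left x) (hint.comp_sub_left x),
    integral_add_left_eq_self, integral_sub_left_eq_self, hk,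
    integral_indicator (measurableSet_le measurable_const (by fun_prop))]
  ring

/-- On test functions, `HTilde` is the limit of the truncated integrals. -/
theorem TestFun.hTildeTendsto {φ : ℝ → ℝ → ℝ} (hφ : TestFun φ) (t x : ℝ) :
    HTildeTendsto (φ t) x (HTilde (φ t) x) := by
  obtain ⟨⟨M, hM⟩, hd, hd', K, hK⟩ := hφ.2 t
  obtain ⟨L, hL⟩ := exists_hTildeTendsto hM hd hd' hK x
  exact tendsto_nhds_limUnder ⟨L, hL⟩

/-- A space-time Hölder function is continuous. -/
theorem continuousOn_of_holder {F : ℝ → ℝ → ℝ} {α C : ℝ} (hα : 0 < α)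
    (hF : ∀ t s x y, 0 ≤ t → 0 ≤ s → |F t x - F s y| ≤ C * (|t - s| + |x - y|) ^ α) :
    ContinuousOn (fun p : ℝ × ℝ => F p.1 p.2) (Ici 0 ×ˢ univ) := by
  rintro ⟨t, x⟩ ⟨ht, -⟩
  have hlim : Tendsto (fun p : ℝ × ℝ => C * (|p.1 - t| + |p.2 - x|) ^ α) (𝓝 (t, x)) (𝓝 0) := by
    have : Continuous fun p : ℝ × ℝ => C * (|p.1 - t| + |p.2 - x|) ^ α :=
      continuous_const.mul (Continuous.rpow_const (by fun_prop) fun _ => Or.inr hα.le)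
    simpa [Real.zero_rpow hα.ne'] using this.tendsto (t, x)
  refine tendsto_iff_dist_tendsto_zero.2
    (squeeze_zero' (Eventually.of_forall fun _ => dist_nonneg) ?_ (hlim.mono_left nhdsWithin_le_nhds))
  filter_upwards [self_mem_nhdsWithin] with p hp
  exact hF p.1 t p.2 x hp.1 ht

/-- The lower semicontinuous envelope of a continuous function is the function itself. -/
theorem lscEnv_eq_of_continuousOn {F : ℝ → ℝ → ℝ}
    (hF : ContinuousOn (fun p : ℝ × ℝ => F p.1 p.2) (Ici 0 ×ˢ univ)) {t : ℝ} (ht : 0 ≤ t)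
    (x : ℝ) : lscEnv F t x = F t x := by
  have hmem : (t, x) ∈ (Ici 0 ×ˢ univ : Set (ℝ × ℝ)) := ⟨ht, mem_univ x⟩
  have : (𝓝[(Ici 0 ×ˢ univ : Set (ℝ × ℝ))] (t, x)).NeBot := nhdsWithin_neBot_of_mem hmem
  exact (hF (t, x) hmem).liminf_eq

/-- A test function touching a differentiable function from above or below has the same first
derivatives at the contact point. -/
theorem TestFun.derivs_eq_of_isLocalExtr {φ : ℝ → ℝ → ℝ} (hφ : TestFun φ) {F : ℝ → ℝ → ℝ}
    {t₀ x₀ a b : ℝ} (ha : HasDerivAt (fun s => F s x₀) a t₀) (hb : HasDerivAt (F t₀) b x₀)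
    (ht : IsLocalExtr (fun t => F t x₀ - φ t x₀) t₀)
    (hx : IsLocalExtr (fun x => F t₀ x - φ t₀ x) x₀) :
    deriv (fun t => φ t x₀) t₀ = a ∧ deriv (φ t₀) x₀ = b := by
  have h₁ := ht.hasDerivAt_eq_zero
    (ha.sub ((hφ.1 x₀).differentiable one_ne_zero t₀).hasDerivAt)
  have h₂ := hx.hasDerivAt_eq_zero (hb.sub ((hφ.2 t₀).2.1 x₀).hasDerivAt)
  exact ⟨(sub_eq_zero.1 h₁).symm, (sub_eq_zero.1 h₂).symm⟩

/-- A bounded classical solution `F` of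
`∂ₜF + (∂ₓF)₊ H̃[F] = 0` on `(0,∞) × ℝ`, with `F` and `∂ₓF` α-Hölder continuous on
`[0,∞) × ℝ`, is a viscosity solution of the equation. -/
theorem classical_solution_is_viscosity_solution
    (α C M : ℝ) (hα : 0 < α) (hC : 0 ≤ C)
    (F Fx Ft : ℝ → ℝ → ℝ)
    (hbdd : ∀ t x, 0 ≤ t → |F t x| ≤ M)
    (hFx : ∀ t x, 0 ≤ t → HasDerivAt (F t) (Fx t x) x)
    (hF_holder : ∀ t s x y, 0 ≤ t → 0 ≤ s →
      |F t x - F s y| ≤ C * (|t - s| + |x - y|) ^ α)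
    (hFx_holder : ∀ t s x y, 0 ≤ t → 0 ≤ s →
      |Fx t x - Fx s y| ≤ C * (|t - s| + |x - y|) ^ α)
    (hFt : ∀ t x, 0 < t → HasDerivAt (fun s => F s x) (Ft t x) t)
    (heq : ∀ t x, 0 < t →
      ∃ L : ℝ, HTildeTendsto (F t) x L ∧ Ft t x + max (Fx t x) 0 * L = 0) :
    IsSolution HTilde F := by
  have hcont := continuousOn_of_holder hα hF_holder
  have hFc {t : ℝ} (ht : 0 ≤ t) : Continuous (F t) :=
    continuous_iff_continuousAt.2 fun x => (hFx t x ht).continuousAt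
  have hφc {φ : ℝ → ℝ → ℝ} (hφ : TestFun φ) (t : ℝ) : Continuous (φ t) :=
    continuous_iff_continuousAt.2 fun x => ((hφ.2 t).2.1 x).continuousAt
  refine ⟨⟨hcont.upperSemicontinuousOn, fun φ hφ t₀ x₀ ht₀ hmax => ?_⟩,
    ⟨?_, fun φ hφ t₀ x₀ ht₀ hmin => ?_⟩⟩
  · have hle (t x : ℝ) (ht : 0 ≤ t) : F t x - φ t x ≤ F t₀ x₀ - φ t₀ x₀ := by
      by_cases h : (t, x) = (t₀, x₀)
      · simp only [Prod.mk.injEq] at h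
        rw [h.1, h.2]
      · exact (hmax t x ht h).le
    obtain ⟨hdt, hdx⟩ := hφ.derivs_eq_of_isLocalExtr (hFt t₀ x₀ ht₀) (hFx t₀ x₀ ht₀.le)
      (Or.inr (by filter_upwards [Ioi_mem_nhds ht₀] with t ht using hle t x₀ (le_of_lt ht)))
      (Or.inr (Eventually.of_forall fun x => hle t₀ x ht₀.le))
    obtain ⟨L, hL, hLeq⟩ := heq t₀ x₀ ht₀
    obtain ⟨N, hN⟩ := (hφ.2 t₀).1
    have hcmp : HTilde (φ t₀) x₀ ≤ L :=
      (hφ.hTildeTendsto t₀ x₀).le_of_increment_le (hφc hφ t₀) (hFc ht₀.le) hN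
        (fun y => hbdd t₀ y ht₀.le) hL fun y => by linarith [hle t₀ y ht₀.le]
    rw [hdt, hdx]
    linarith [mul_le_mul_of_nonneg_left hcmp (le_max_right (Fx t₀ x₀) 0)]
  · exact (hcont.congr fun p hp => lscEnv_eq_of_continuousOn hcont hp.1 p.2).lowerSemicontinuousOn
  · have hle (t x : ℝ) (ht : 0 ≤ t) : F t₀ x₀ - φ t₀ x₀ ≤ F t x - φ t x := by
      by_cases h : (t, x) = (t₀, x₀)
      · simp only [Prod.mk.injEq] at h
        rw [h.1, h.2]
      · have := hmin t x ht h
        simp only [lscEnv_eq_of_continuousOn hcont ht,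
          lscEnv_eq_of_continuousOn hcont ht₀.le] at this
        exact this.le
    obtain ⟨hdt, hdx⟩ := hφ.derivs_eq_of_isLocalExtr (hFt t₀ x₀ ht₀) (hFx t₀ x₀ ht₀.le)
      (Or.inl (by filter_upwards [Ioi_mem_nhds ht₀] with t ht using hle t x₀ (le_of_lt ht)))
      (Or.inl (Eventually.of_forall fun x => hle t₀ x ht₀.le))
    obtain ⟨L, hL, hLeq⟩ := heq t₀ x₀ ht₀
    obtain ⟨N, hN⟩ := (hφ.2 t₀).1
    have hcmp : L ≤ HTilde (φ t₀) x₀ :=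
      hL.le_of_increment_le (hFc ht₀.le) (hφc hφ t₀) (fun y => hbdd t₀ y ht₀.le) hN
        (hφ.hTildeTendsto t₀ x₀) fun y => by linarith [hle t₀ y ht₀.le]
    rw [hdt, hdx]
    linarith [mul_le_mul_of_nonneg_left hcmp (le_max_right (Fx t₀ x₀) 0)]
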